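/- Let N ≥ 2, let a₁, …, a_N > 0 and b₁, …, b_N ∈ ℝ, and for p ∈ ℝ let h(p) be the real symmetric tridiagonal N×N matrix with diagonal entries b₁, …, b_{N−1}, b_N + 2a_N cos p and off-diagonal entries a₁, …, a_{N−1}. Suppose λ : ℝ → ℝ and W : ℝ → ℂ^N are differentiable functions such that for all p ∈ ℝ, ‖W(p)‖ = 1 and h(p)W(p) = λ(p)W(p). Then λ'(p) = −2 a_N·|W_N(p)|²·sin p for all p, and λ'(p) < 0 for every p ∈ (0, π); in particular λ is strictly decreasing on [0, π]. -/

import Mathlib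

open Matrix Complex

/-- The real symmetric tridiagonal `N×N` matrix with diagonal `b 0, …, b (N-1)`
and off-diagonal entries `a 0, …, a (N-2)`. -/
noncomputable def triR (N : ℕ) (a b : ℕ → ℝ) : Matrix (Fin N) (Fin N) ℝ :=
  Matrix.of fun i j =>
    if (i : ℕ) = (j : ℕ) then b i
    else if (i : ℕ) + 1 = (j : ℕ) then a i
    else if (j : ℕ) + 1 = (i : ℕ) then a j
    else 0

/-- `h(p)`: real symmetric tridiagonal with diagonal
`b₁, …, b_{N-1}, b_N + 2 a_N cos p` and off-diagonal entries `a₁, …, a_{N-1}`. -/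
noncomputable def htri (N : ℕ) (a b : ℕ → ℝ) (p : ℝ) : Matrix (Fin N) (Fin N) ℝ :=
  triR N a (fun k => if k = N - 1 then b k + 2 * a (N - 1) * Real.cos p else b k)

/-- Changing `p` alters only the last diagonal entry of `htri`. -/
lemma htri_apply_eq_add (N : ℕ) (a b : ℕ → ℝ) (p q : ℝ) (i j l : Fin N)
    (hl : (l : ℕ) = N - 1) :
    htri N a b q i j = htri N a b p i j
      + if i = l ∧ j = l then 2 * a (N - 1) * (Real.cos q - Real.cos p) else 0 := by
  simp only [htri, triR, Matrix.of_apply, Fin.ext_iff, hl]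
  split_ifs <;> first | omega | ring

lemma htri_symm (N : ℕ) (a b : ℕ → ℝ) (p : ℝ) (i j : Fin N) :
    htri N a b p i j = htri N a b p j i := by
  simp only [htri, triR, Matrix.of_apply]
  split_ifs <;> first | omega | simp_all

/-- An eigenvector of a tridiagonal matrix with nonzero off-diagonal entries whose last
coordinate vanishes is zero. -/
lemma triR_eigenvector_eq_zero (N : ℕ) (a b : ℕ → ℝ) (ha : ∀ k, k + 1 < N → a k ≠ 0)
    (μ : ℂ) (w : Fin N → ℂ)
    (heig : ∀ i, ∑ j, (triR N a b i j : ℂ) * w j = μ * w i)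
    (l : Fin N) (hl : (l : ℕ) = N - 1) (hwl : w l = 0) (i : Fin N) : w i = 0 := by
  have key : ∀ m : ℕ, ∀ i : Fin N, N - 1 ≤ i + m → w i = 0 := by
    intro m
    induction m with
    | zero =>
      intro i hi
      rwa [show i = l from Fin.ext (by omega)]
    | succ m ih =>
      intro i hi
      by_cases hlt : N - 1 ≤ i + m
      · exact ih i hlt
      have hi' : (i : ℕ) + 1 < N := by omega
      have hrow := heig ⟨i + 1, hi'⟩
      rw [ih ⟨i + 1, hi'⟩ (by simp only; omega), mul_zero,
        Finset.sum_eq_single i] at hrow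
      · simpa [triR, ha i hi', show (i : ℕ) + 1 + 1 ≠ i by omega] using hrow
      · intro j _ hj
        have hne : (j : ℕ) ≠ i := fun h => hj (Fin.ext h)
        rcases lt_or_gt_of_ne hne with h | h
        · have hT : triR N a b ⟨i + 1, hi'⟩ j = 0 := by
            simp only [triR, Matrix.of_apply]
            split_ifs <;> first | omega | rfl
          simp [hT]
        · simp [ih j (by omega)]
      · simp
  exact key N i (by omega)

/-- Pairing the eigenvalue equations at `p` and `q` and using the symmetry of `htri`. -/
lemma htri_eigenvalue_sub_mul_sum (N : ℕ) (a b : ℕ → ℝ) (p q lp lq : ℝ) (v w : Fin N → ℂ)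
    (hv : ∀ i, ∑ j, (htri N a b p i j : ℂ) * v j = lp * v i)
    (hw : ∀ i, ∑ j, (htri N a b q i j : ℂ) * w j = lq * w i)
    (l : Fin N) (hl : (l : ℕ) = N - 1) :
    ((lq - lp : ℝ) : ℂ) * ∑ i, star (v i) * w i
      = ((2 * a (N - 1) * (Real.cos q - Real.cos p) : ℝ) : ℂ) * (star (v l) * w l) := by
  have hq : (lq : ℂ) * ∑ i, star (v i) * w i
      = ∑ i, ∑ j, star (v i) * ((htri N a b q i j : ℂ) * w j) := by
    simp_rw [← Finset.mul_sum, hw, Finset.mul_sum]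
    exact Finset.sum_congr rfl fun i _ => by ring
  have hp : (lp : ℂ) * ∑ i, star (v i) * w i
      = ∑ i, ∑ j, star (v i) * ((htri N a b p i j : ℂ) * w j) := by
    rw [Finset.sum_comm, Finset.mul_sum]
    refine Finset.sum_congr rfl fun j _ => ?_
    have h := congrArg star (hv j)
    simp only [star_sum, star_mul', Complex.star_def, Complex.conj_ofReal] at h
    rw [← mul_assoc, Complex.star_def, ← h, Finset.sum_mul]
    exact Finset.sum_congr rfl fun i _ => by rw [htri_symm N a b p j i]; ring
  rw [Complex.ofReal_sub, sub_mul, hq, hp, ← Finset.sum_sub_distrib]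
  simp_rw [← Finset.sum_sub_distrib]
  rw [Finset.sum_eq_single l, Finset.sum_eq_single l]
  · rw [htri_apply_eq_add N a b p q l l l hl]
    simp only [and_self, if_true, Complex.ofReal_add]
    ring
  · intro j _ hj
    simp [htri_apply_eq_add N a b p q l j l hl, hj]
  · simp
  · intro i _ hi
    simp [htri_apply_eq_add N a b p q i _ l hl, hi]
  · simp

/-- For a differentiable normalized eigenpair branch
`(λ(p), W(p))` of `h(p)` one has `λ'(p) = -2 a_N |W_N(p)|² sin p` for all `p`,
`λ'(p) < 0` on `(0, π)`, and `λ` is strictly decreasing on `[0, π]`. -/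
theorem htri_eigenvalue_decreasing (N : ℕ) (hN : 2 ≤ N) (a b : ℕ → ℝ)
    (ha : ∀ k < N, 0 < a k)
    (lam : ℝ → ℝ) (W : ℝ → EuclideanSpace ℂ (Fin N))
    (hlam : Differentiable ℝ lam) (hW : Differentiable ℝ W)
    (hnorm : ∀ p : ℝ, ‖W p‖ = 1)
    (heig : ∀ p : ℝ,
      ((htri N a b p).map (Complex.ofReal)) *ᵥ (W p) = (lam p : ℂ) • W p) :
    (∀ p : ℝ, deriv lam p
      = -2 * a (N - 1) * ‖W p (⟨N - 1, by omega⟩ : Fin N)‖ ^ 2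
          * Real.sin p) ∧
    (∀ p ∈ Set.Ioo (0 : ℝ) Real.pi, deriv lam p < 0) ∧
    StrictAntiOn lam (Set.Icc 0 Real.pi) := by
  set l : Fin N := ⟨N - 1, by omega⟩
  have hrow : ∀ p i, ∑ j, (htri N a b p i j : ℂ) * W p j = lam p * W p i := fun p i => by
    simpa [Matrix.mulVec, dotProduct] using congrFun (heig p) i
  have hsum : ∀ p, ∑ i, star (W p i) * W p i = 1 := fun p => by
    have h := EuclideanSpace.norm_sq_eq (W p)
    rw [hnorm p, one_pow] at h
    simp_rw [Complex.star_def, Complex.conj_mul']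
    exact_mod_cast h.symm
  have hderiv : ∀ p : ℝ, deriv lam p = -2 * a (N - 1) * ‖W p l‖ ^ 2 * Real.sin p := by
    intro p
    have hWi : ∀ i, DifferentiableAt ℝ (fun q => W q i) p := fun i =>
      ((EuclideanSpace.proj i : EuclideanSpace ℂ (Fin N) →L[ℂ] ℂ).restrictScalars
        ℝ).differentiableAt.comp p (hW p)
    have hL := ((hlam p).hasDerivAt.sub_const (lam p)).ofReal_comp.fun_mul
      (HasDerivAt.fun_sum (u := Finset.univ) fun i _ =>
        (hWi i).hasDerivAt.const_mul (star (W p i)))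
    have hR := (((Real.hasDerivAt_cos p).sub_const (Real.cos p)).const_mul
      (2 * a (N - 1))).ofReal_comp.fun_mul ((hWi l).hasDerivAt.const_mul (star (W p l)))
    have hfun := funext fun q =>
      htri_eigenvalue_sub_mul_sum N a b p q (lam p) (lam q) (W p) (W q) (hrow p) (hrow q) l rfl
    have h := hL.unique (hfun ▸ hR)
    simp only [sub_self, mul_zero, Complex.ofReal_zero, zero_mul, add_zero, hsum, mul_one] at h
    rw [Complex.star_def, Complex.conj_mul'] at h
    have h' : deriv lam p = 2 * a (N - 1) * -Real.sin p * ‖W p l‖ ^ 2 := by exact_mod_cast h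
    rw [h']
    ring
  have hlast : ∀ p, W p l ≠ 0 := fun p h0 => by
    have hzero := triR_eigenvector_eq_zero N a _ (fun k hk => (ha k (by omega)).ne') (lam p)
      (W p) (hrow p) l rfl h0
    simpa [hzero] using hsum p
  have hneg : ∀ p ∈ Set.Ioo (0 : ℝ) Real.pi, deriv lam p < 0 := fun p hp => by
    have hpos : 0 < a (N - 1) * ‖W p l‖ ^ 2 * Real.sin p :=
      mul_pos (mul_pos (ha _ (by omega)) (pow_pos (norm_pos_iff.2 (hlast p)) 2))
        (Real.sin_pos_of_mem_Ioo hp)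
    rw [hderiv p]
    linarith
  refine ⟨hderiv, hneg, strictAntiOn_of_deriv_neg (convex_Icc _ _) hlam.continuous.continuousOn ?_⟩
  rwa [interior_Icc]
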